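/- Let (X,T) be a nonautonomous dynamical system, K ⊂ X_0 a non-empty compact set, and f = (f_k) an equicontinuous sequence of continuous real-valued potentials with ‖f‖ = sup_k ‖f_k‖_∞ < +∞. If P^P(T,f,K) > ‖f‖, then P^P(T,f,K) = sup{ P̄_μ(T,f) : μ is a Borel probability measure on X_0 with μ(K) = 1 }. -/

import Mathlib

open Filter MeasureTheory Set
open scoped ENNReal Topology

namespace NDS

variable {X : ℕ → Type*}

/-- Iterates `T^j : X 0 → X j` of a nonautonomous dynamical system `T`. -/
def iter (T : ∀ k, X k → X (k + 1)) : ∀ j, X 0 → X j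
  | 0 => fun x => x
  | j + 1 => fun x => T j (iter T j x)

/-- The Birkhoff-type sum `S_n^T f (x) = ∑_{j<n} f_j (T^j x)`. -/
def birk (T : ∀ k, X k → X (k + 1)) (f : ∀ k, X k → ℝ) (n : ℕ) (x : X 0) : ℝ :=
  ∑ j ∈ Finset.range n, f j (iter T j x)

/-- The uniform norm `‖f‖ = sup_k sup_x |f_k x|` of a sequence of potentials. -/
noncomputable def fnorm (f : ∀ k, X k → ℝ) : ℝ :=
  ⨆ k : ℕ, ⨆ x : X k, |f k x|

/-- `log : ℝ≥0∞ → EReal` with the conventions `log 0 = -∞`, `log ∞ = ∞`. -/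
noncomputable def elog (x : ℝ≥0∞) : EReal :=
  if x = 0 then ⊥ else if x = ⊤ then ⊤ else ((Real.log x.toReal : ℝ) : EReal)

/-- The nonnegative part of an extended real, as an element of `ℝ≥0∞`. -/
noncomputable def toENN (x : EReal) : ℝ≥0∞ :=
  if x = ⊤ then ⊤ else ENNReal.ofReal x.toReal

/-- The canonical map `ℝ≥0∞ → EReal`. -/
noncomputable def ofENN (x : ℝ≥0∞) : EReal :=
  if x = ⊤ then ⊤ else ((x.toReal : ℝ) : EReal)

/-- The integral of an extended-real-valued function: the difference of the lower
integrals of its positive and negative parts. -/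
noncomputable def eInt {α : Type*} [MeasurableSpace α] (μ : Measure α) (g : α → EReal) : EReal :=
  ofENN (∫⁻ x, toENN (g x) ∂μ) - ofENN (∫⁻ x, toENN (-g x) ∂μ)

section Metric

variable [∀ k, MetricSpace (X k)]

/-- The open Bowen ball `B_n^T(x,ε)`. -/
def bowenBall (T : ∀ k, X k → X (k + 1)) (n : ℕ) (ε : ℝ) (x : X 0) : Set (X 0) :=
  {y | ∀ j < n, dist (iter T j x) (iter T j y) < ε}

/-- The closed Bowen ball `B̄_n^T(x,ε)`. -/
def bowenClosedBall (T : ∀ k, X k → X (k + 1)) (n : ℕ) (ε : ℝ) (x : X 0) : Set (X 0) :=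
  {y | ∀ j < n, dist (iter T j x) (iter T j y) ≤ ε}

/-- Equicontinuity of a sequence of potentials `f = (f_k)`. -/
def EquicontPotential (f : ∀ k, X k → ℝ) : Prop :=
  ∀ ε : ℝ, 0 < ε → ∃ δ : ℝ, 0 < δ ∧ ∀ k, ∀ x y : X k, dist x y < δ → |f k x - f k y| < ε

/-- The supremum of the Birkhoff sum `S_n^T f` over a subset `A` of `X 0`. -/
noncomputable def supBirk (T : ∀ k, X k → X (k + 1)) (f : ∀ k, X k → ℝ) (n : ℕ)
    (A : Set (X 0)) : ℝ :=
  ⨆ y : A, birk T f n (y : X 0)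

/-- Measure-theoretic lower local pressure `P̲_μ(T,f,x)`. -/
noncomputable def localLowerPres [MeasurableSpace (X 0)] (μ : Measure (X 0))
    (T : ∀ k, X k → X (k + 1)) (f : ∀ k, X k → ℝ) (x : X 0) : EReal :=
  ⨆ (ε : ℝ) (_ : 0 < ε),
    liminf (fun n : ℕ =>
      (((n : ℝ)⁻¹ : ℝ) : EReal) *
        (-(elog (μ (bowenBall T n ε x))) + ((birk T f n x : ℝ) : EReal))) atTop

/-- Measure-theoretic upper local pressure `P̄_μ(T,f,x)`. -/
noncomputable def localUpperPres [MeasurableSpace (X 0)] (μ : Measure (X 0))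
    (T : ∀ k, X k → X (k + 1)) (f : ∀ k, X k → ℝ) (x : X 0) : EReal :=
  ⨆ (ε : ℝ) (_ : 0 < ε),
    limsup (fun n : ℕ =>
      (((n : ℝ)⁻¹ : ℝ) : EReal) *
        (-(elog (μ (bowenBall T n ε x))) + ((birk T f n x : ℝ) : EReal))) atTop

/-- Measure-theoretic lower local entropy `h̲_μ(T,x)`. -/
noncomputable def localLowerEnt [MeasurableSpace (X 0)] (μ : Measure (X 0))
    (T : ∀ k, X k → X (k + 1)) (x : X 0) : EReal :=
  ⨆ (ε : ℝ) (_ : 0 < ε),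
    liminf (fun n : ℕ =>
      (((n : ℝ)⁻¹ : ℝ) : EReal) * (-(elog (μ (bowenBall T n ε x))))) atTop

/-- Measure-theoretic upper local entropy `h̄_μ(T,x)`. -/
noncomputable def localUpperEnt [MeasurableSpace (X 0)] (μ : Measure (X 0))
    (T : ∀ k, X k → X (k + 1)) (x : X 0) : EReal :=
  ⨆ (ε : ℝ) (_ : 0 < ε),
    limsup (fun n : ℕ =>
      (((n : ℝ)⁻¹ : ℝ) : EReal) * (-(elog (μ (bowenBall T n ε x))))) atTop

/-- Measure-theoretic lower pressure `P̲_μ(T,f) = ∫ P̲_μ(T,f,x) dμ(x)`. -/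
noncomputable def lowerPres [MeasurableSpace (X 0)] (μ : Measure (X 0))
    (T : ∀ k, X k → X (k + 1)) (f : ∀ k, X k → ℝ) : EReal :=
  eInt μ (fun x => localLowerPres μ T f x)

/-- Measure-theoretic upper pressure `P̄_μ(T,f) = ∫ P̄_μ(T,f,x) dμ(x)`. -/
noncomputable def upperPres [MeasurableSpace (X 0)] (μ : Measure (X 0))
    (T : ∀ k, X k → X (k + 1)) (f : ∀ k, X k → ℝ) : EReal :=
  eInt μ (fun x => localUpperPres μ T f x)

/-- Measure-theoretic lower entropy `h̲_μ(T) = ∫ h̲_μ(T,x) dμ(x)`. -/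
noncomputable def lowerEnt [MeasurableSpace (X 0)] (μ : Measure (X 0))
    (T : ∀ k, X k → X (k + 1)) : EReal :=
  eInt μ (fun x => localLowerEnt μ T x)

/-- Measure-theoretic upper entropy `h̄_μ(T) = ∫ h̄_μ(T,x) dμ(x)`. -/
noncomputable def upperEnt [MeasurableSpace (X 0)] (μ : Measure (X 0))
    (T : ∀ k, X k → X (k + 1)) : EReal :=
  eInt μ (fun x => localUpperEnt μ T x)

/-- The Bowen premeasure `M^s_{N,ε}(T,f,Z)`: the infimum of
`∑ exp(-n_i s + S_{n_i}^T f(x_i))` over all countable `(N,ε)`-covers of `Z` by open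
Bowen balls `B_{n_i}^T(x_i,ε)` with `n_i ≥ N`. -/
noncomputable def bowenPre (T : ∀ k, X k → X (k + 1)) (f : ∀ k, X k → ℝ)
    (s : ℝ) (N : ℕ) (ε : ℝ) (Z : Set (X 0)) : ℝ≥0∞ :=
  ⨅ (D : Set (X 0 × ℕ)) (_ : D.Countable) (_ : ∀ p ∈ D, N ≤ p.2)
      (_ : Z ⊆ ⋃ p ∈ D, bowenBall T p.2 ε p.1),
    ∑' p : D, ENNReal.ofReal (Real.exp (-(p.1.2 : ℝ) * s + birk T f p.1.2 p.1.1))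

/-- `M^s_ε(T,f,Z) = lim_{N→∞} M^s_{N,ε}(T,f,Z)` (an increasing limit). -/
noncomputable def bowenPreLim (T : ∀ k, X k → X (k + 1)) (f : ∀ k, X k → ℝ)
    (s : ℝ) (ε : ℝ) (Z : Set (X 0)) : ℝ≥0∞ :=
  ⨆ N : ℕ, bowenPre T f s N ε Z

/-- The critical value `P^B(T,f,Z,ε) = inf {s : M^s_ε(T,f,Z) = 0}`. -/
noncomputable def bowenCrit (T : ∀ k, X k → X (k + 1)) (f : ∀ k, X k → ℝ)
    (ε : ℝ) (Z : Set (X 0)) : EReal :=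
  ⨅ (s : ℝ) (_ : bowenPreLim T f s ε Z = 0), (s : EReal)

/-- The Bowen (Pesin–Pitskel') topological pressure
`P^B(T,f,Z) = lim_{ε→0} P^B(T,f,Z,ε)` (an increasing limit as `ε ↓ 0`). -/
noncomputable def bowenP (T : ∀ k, X k → X (k + 1)) (f : ∀ k, X k → ℝ)
    (Z : Set (X 0)) : EReal :=
  ⨆ (ε : ℝ) (_ : 0 < ε), bowenCrit T f ε Z

/-- The Bowen topological entropy `h^B(T,Z) = P^B(T,0,Z)`. -/
noncomputable def bowenEnt (T : ∀ k, X k → X (k + 1)) (Z : Set (X 0)) : EReal :=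
  bowenP T (fun k => fun _ : X k => (0 : ℝ)) Z

/-- The premeasure `N^s_{N,ε}(T,f,Z)` using suprema of Birkhoff sums over the balls. -/
noncomputable def nBowenPre (T : ∀ k, X k → X (k + 1)) (f : ∀ k, X k → ℝ)
    (s : ℝ) (N : ℕ) (ε : ℝ) (Z : Set (X 0)) : ℝ≥0∞ :=
  ⨅ (D : Set (X 0 × ℕ)) (_ : D.Countable) (_ : ∀ p ∈ D, N ≤ p.2)
      (_ : Z ⊆ ⋃ p ∈ D, bowenBall T p.2 ε p.1),
    ∑' p : D, ENNReal.ofReal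
      (Real.exp (-(p.1.2 : ℝ) * s + supBirk T f p.1.2 (bowenBall T p.1.2 ε p.1.1)))

/-- `N^s_ε(T,f,Z) = lim_{N→∞} N^s_{N,ε}(T,f,Z)`. -/
noncomputable def nBowenPreLim (T : ∀ k, X k → X (k + 1)) (f : ∀ k, X k → ℝ)
    (s : ℝ) (ε : ℝ) (Z : Set (X 0)) : ℝ≥0∞ :=
  ⨆ N : ℕ, nBowenPre T f s N ε Z

/-- The critical value `Q^B(T,f,Z,ε) = inf {s : N^s_ε(T,f,Z) = 0}`. -/
noncomputable def nBowenCrit (T : ∀ k, X k → X (k + 1)) (f : ∀ k, X k → ℝ)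
    (ε : ℝ) (Z : Set (X 0)) : EReal :=
  ⨅ (s : ℝ) (_ : nBowenPreLim T f s ε Z = 0), (s : EReal)

/-- The weighted Bowen premeasure `W^s_{N,ε}(T,f,g)`: the infimum of
`∑ c_i exp(-n_i s + sup_{B_{n_i}^T(x_i,ε)} S_{n_i}^T f)` over all countable families
`{(B_{n_i}^T(x_i,ε), c_i)}` with `0 < c_i`, `n_i ≥ N` and `∑ c_i χ_{B_i} ≥ g`. -/
noncomputable def wBowenPre (T : ∀ k, X k → X (k + 1)) (f : ∀ k, X k → ℝ)
    (s : ℝ) (N : ℕ) (ε : ℝ) (g : X 0 → ℝ) : ℝ≥0∞ :=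
  ⨅ (D : Set ((X 0 × ℕ) × ℝ)) (_ : D.Countable)
      (_ : ∀ p ∈ D, N ≤ p.1.2 ∧ 0 < p.2)
      (_ : ∀ x : X 0, ENNReal.ofReal (g x) ≤
        ∑' p : D, (bowenBall T p.1.1.2 ε p.1.1.1).indicator
          (fun _ => ENNReal.ofReal p.1.2) x),
    ∑' p : D, ENNReal.ofReal p.1.2 *
      ENNReal.ofReal
        (Real.exp (-(p.1.1.2 : ℝ) * s + supBirk T f p.1.1.2 (bowenBall T p.1.1.2 ε p.1.1.1)))

/-- `D` is a countable `(N,ε)`-packing of `Z`: the closed Bowen balls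
`B̄_{n}^T(x,ε)`, `(x,n) ∈ D`, are pairwise disjoint with centers in `Z` and orders `≥ N`. -/
def IsPacking (T : ∀ k, X k → X (k + 1)) (N : ℕ) (ε : ℝ) (Z : Set (X 0))
    (D : Set (X 0 × ℕ)) : Prop :=
  D.Countable ∧ (∀ p ∈ D, p.1 ∈ Z ∧ N ≤ p.2) ∧
    ∀ p ∈ D, ∀ q ∈ D, p ≠ q →
      Disjoint (bowenClosedBall T p.2 ε p.1) (bowenClosedBall T q.2 ε q.1)

/-- The packing premeasure `P^s_{N,ε}(T,f,Z)`: the supremum of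
`∑ exp(-n_i s + S_{n_i}^T f(x_i))` over all countable `(N,ε)`-packings of `Z`. -/
noncomputable def packPre (T : ∀ k, X k → X (k + 1)) (f : ∀ k, X k → ℝ)
    (s : ℝ) (N : ℕ) (ε : ℝ) (Z : Set (X 0)) : ℝ≥0∞ :=
  ⨆ (D : Set (X 0 × ℕ)) (_ : IsPacking T N ε Z D),
    ∑' p : D, ENNReal.ofReal (Real.exp (-(p.1.2 : ℝ) * s + birk T f p.1.2 p.1.1))

/-- `P^s_{∞,ε}(T,f,Z) = lim_{N→∞} P^s_{N,ε}(T,f,Z)` (a decreasing limit). -/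
noncomputable def packPreInf (T : ∀ k, X k → X (k + 1)) (f : ∀ k, X k → ℝ)
    (s : ℝ) (ε : ℝ) (Z : Set (X 0)) : ℝ≥0∞ :=
  ⨅ N : ℕ, packPre T f s N ε Z

/-- The packing measure-like quantity
`P^s_ε(T,f,Z) = inf { ∑_i P^s_{∞,ε}(T,f,Z_i) : Z ⊆ ⋃_i Z_i }`. -/
noncomputable def packMeasure (T : ∀ k, X k → X (k + 1)) (f : ∀ k, X k → ℝ)
    (s : ℝ) (ε : ℝ) (Z : Set (X 0)) : ℝ≥0∞ :=
  ⨅ (Zs : ℕ → Set (X 0)) (_ : Z ⊆ ⋃ i, Zs i), ∑' i, packPreInf T f s ε (Zs i)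

/-- The critical value `P^P(T,f,Z,ε) = inf {s : P^s_ε(T,f,Z) = 0}`. -/
noncomputable def packCrit (T : ∀ k, X k → X (k + 1)) (f : ∀ k, X k → ℝ)
    (ε : ℝ) (Z : Set (X 0)) : EReal :=
  ⨅ (s : ℝ) (_ : packMeasure T f s ε Z = 0), (s : EReal)

/-- The packing topological pressure `P^P(T,f,Z) = lim_{ε→0} P^P(T,f,Z,ε)`. -/
noncomputable def packP (T : ∀ k, X k → X (k + 1)) (f : ∀ k, X k → ℝ)
    (Z : Set (X 0)) : EReal :=
  ⨆ (ε : ℝ) (_ : 0 < ε), packCrit T f ε Z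

/-- The packing topological entropy `h^P(T,Z) = P^P(T,0,Z)`. -/
noncomputable def packEnt (T : ∀ k, X k → X (k + 1)) (Z : Set (X 0)) : EReal :=
  packP T (fun k => fun _ : X k => (0 : ℝ)) Z

/-- The packing premeasure `Q^s_{N,ε}(T,f,Z)` using suprema of Birkhoff sums over the balls. -/
noncomputable def qPackPre (T : ∀ k, X k → X (k + 1)) (f : ∀ k, X k → ℝ)
    (s : ℝ) (N : ℕ) (ε : ℝ) (Z : Set (X 0)) : ℝ≥0∞ :=
  ⨆ (D : Set (X 0 × ℕ)) (_ : IsPacking T N ε Z D),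
    ∑' p : D, ENNReal.ofReal
      (Real.exp (-(p.1.2 : ℝ) * s + supBirk T f p.1.2 (bowenClosedBall T p.1.2 ε p.1.1)))

/-- `Q^s_{∞,ε}(T,f,Z) = lim_{N→∞} Q^s_{N,ε}(T,f,Z)`. -/
noncomputable def qPackPreInf (T : ∀ k, X k → X (k + 1)) (f : ∀ k, X k → ℝ)
    (s : ℝ) (ε : ℝ) (Z : Set (X 0)) : ℝ≥0∞ :=
  ⨅ N : ℕ, qPackPre T f s N ε Z

/-- `Q^s_ε(T,f,Z) = inf { ∑_i Q^s_{∞,ε}(T,f,Z_i) : Z ⊆ ⋃_i Z_i }`. -/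
noncomputable def qPackMeasure (T : ∀ k, X k → X (k + 1)) (f : ∀ k, X k → ℝ)
    (s : ℝ) (ε : ℝ) (Z : Set (X 0)) : ℝ≥0∞ :=
  ⨅ (Zs : ℕ → Set (X 0)) (_ : Z ⊆ ⋃ i, Zs i), ∑' i, qPackPreInf T f s ε (Zs i)

/-- The critical value `Q^P(T,f,Z,ε) = inf {s : Q^s_ε(T,f,Z) = 0}`. -/
noncomputable def qPackCrit (T : ∀ k, X k → X (k + 1)) (f : ∀ k, X k → ℝ)
    (ε : ℝ) (Z : Set (X 0)) : EReal :=
  ⨅ (s : ℝ) (_ : qPackMeasure T f s ε Z = 0), (s : EReal)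

end Metric

/-- The distance function of an explicitly given metric space structure. -/
def mdist {α : Type*} (m : MetricSpace α) (x y : α) : ℝ :=
  @dist α m.toPseudoMetricSpace.toDist x y

/-- Every sequence of probability measures on a compact metric space has a cluster measure, and
eventual upper bounds on open sets pass to it. -/
lemma exists_probabilityMeasure_limit_open_le {E : Type*} [MetricSpace E] [CompactSpace E]
    [MeasurableSpace E] [BorelSpace E] (ν : ℕ → ProbabilityMeasure E) :
    ∃ μ : ProbabilityMeasure E, ∀ G : Set E, IsOpen G → ∀ c : ℝ≥0∞,
      (∀ᶠ j in atTop, (ν j : Measure E) G ≤ c) → (μ : Measure E) G ≤ c := by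
  let U : Ultrafilter ℕ := hyperfilter ℕ
  obtain ⟨μ, -, hμ⟩ := isCompact_univ.ultrafilter_le_nhds (U.map ν) (by simp)
  refine ⟨μ, fun G hG c hc => ?_⟩
  refine (ProbabilityMeasure.le_liminf_measure_open_of_tendsto (L := (U : Filter ℕ))
    (μs := ν) hμ hG).trans ?_
  refine liminf_le_of_frequently_le' ?_
  exact (hc.filter_mono Nat.hyperfilter_le_atTop).frequently

section eInt

variable {α : Type*} [MeasurableSpace α] {μ : Measure α} [IsProbabilityMeasure μ]

lemma ofENN_mono {a b : ℝ≥0∞} (h : a ≤ b) : ofENN a ≤ ofENN b := by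
  unfold ofENN
  split_ifs with h1 h2 h2
  · exact le_rfl
  · exact absurd (top_le_iff.1 (h1 ▸ h)) h2
  · exact le_top
  · exact_mod_cast ENNReal.toReal_mono h2 h

lemma toENN_mono_of_coe_le {s : ℝ} {x : EReal} (h : (s : EReal) ≤ x) :
    ENNReal.ofReal s ≤ toENN x := by
  unfold toENN
  split_ifs with h1
  · exact le_top
  · apply ENNReal.ofReal_le_ofReal
    induction x with
    | bot => simp at h
    | top => simp at h1
    | coe x => exact_mod_cast h

lemma toENN_le_of_le_coe {s : ℝ} {x : EReal} (h : x ≤ (s : EReal)) :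
    toENN x ≤ ENNReal.ofReal s := by
  unfold toENN
  split_ifs with h1
  · simp [h1] at h
  · induction x with
    | bot => simp
    | top => simp at h1
    | coe x => exact ENNReal.ofReal_le_ofReal (by exact_mod_cast h)

lemma ofENN_ofReal_sub (s : ℝ) :
    ofENN (ENNReal.ofReal s) - ofENN (ENNReal.ofReal (-s)) = s := by
  simp only [ofENN, ENNReal.ofReal_ne_top, if_false, ENNReal.toReal_ofReal']
  rw [← EReal.coe_sub]
  congr 1
  exact max_zero_sub_max_neg_zero_eq_self s

lemma le_eInt_of_ae_le {s : ℝ} {g : α → EReal} (h : ∀ᵐ x ∂μ, (s : EReal) ≤ g x) :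
    (s : EReal) ≤ eInt μ g := by
  rw [← ofENN_ofReal_sub s]
  refine EReal.sub_le_sub (ofENN_mono ?_) (ofENN_mono ?_)
  · calc ENNReal.ofReal s = ∫⁻ _, ENNReal.ofReal s ∂μ := by simp
      _ ≤ _ := lintegral_mono_ae (h.mono fun x hx => toENN_mono_of_coe_le hx)
  · calc ∫⁻ x, toENN (-g x) ∂μ ≤ ∫⁻ _, ENNReal.ofReal (-s) ∂μ :=
          lintegral_mono_ae (h.mono fun x hx => toENN_le_of_le_coe (by
            rw [EReal.coe_neg]; exact EReal.neg_le_neg_iff.2 hx))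
      _ = _ := by simp

lemma eInt_le_of_ae_le {s : ℝ} {g : α → EReal} (h : ∀ᵐ x ∂μ, g x ≤ (s : EReal)) :
    eInt μ g ≤ (s : EReal) := by
  rw [← ofENN_ofReal_sub s]
  refine EReal.sub_le_sub (ofENN_mono ?_) (ofENN_mono ?_)
  · calc ∫⁻ x, toENN (g x) ∂μ ≤ ∫⁻ _, ENNReal.ofReal s ∂μ :=
          lintegral_mono_ae (h.mono fun x hx => toENN_le_of_le_coe hx)
      _ = _ := by simp
  · calc ENNReal.ofReal (-s) = ∫⁻ _, ENNReal.ofReal (-s) ∂μ := by simp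
      _ ≤ _ := lintegral_mono_ae (h.mono fun x hx => toENN_mono_of_coe_le (by
            rw [EReal.coe_neg]; exact EReal.neg_le_neg_iff.2 hx))

end eInt

/-- `-log a + c` exceeds `n s` exactly when `a < exp (c - n s)`. -/
lemma lt_inv_mul_neg_elog_add_iff {n : ℕ} (hn : n ≠ 0) {a : ℝ≥0∞} (ha : a ≠ ⊤) (s c : ℝ) :
    (s : EReal) < (((n : ℝ)⁻¹ : ℝ) : EReal) * (-(elog a) + (c : EReal)) ↔
      a < ENNReal.ofReal (Real.exp (-(n : ℝ) * s + c)) := by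
  have hn' : (0 : ℝ) < n := by positivity
  rcases eq_or_ne a 0 with rfl | h0
  · have : (0 : ℝ) < (n : ℝ)⁻¹ := by positivity
    simp [elog, EReal.coe_mul_top_of_pos this, Real.exp_pos]
  · have hpos : 0 < a.toReal := ENNReal.toReal_pos h0 ha
    simp only [elog, h0, ha, if_false]
    rw [← EReal.coe_neg, ← EReal.coe_add, ← EReal.coe_mul, EReal.coe_lt_coe_iff,
      ENNReal.lt_ofReal_iff_toReal_lt ha, ← Real.log_lt_iff_lt_exp hpos, lt_inv_mul_iff₀ hn']
    constructor <;> intro h <;> linarith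

/-- If `a ≤ C exp (c - n s)` then `s - log C / n ≤ n⁻¹ (-log a + c)`. -/
lemma sub_le_inv_mul_neg_elog_add {n : ℕ} (hn : n ≠ 0) {a : ℝ≥0∞} {s c b : ℝ}
    (h : a ≤ ENNReal.ofReal (Real.exp (-(n : ℝ) * s + c + b))) :
    ((s - b / n : ℝ) : EReal) ≤ (((n : ℝ)⁻¹ : ℝ) : EReal) * (-(elog a) + (c : EReal)) := by
  have hn' : (0 : ℝ) < n := by positivity
  have ha : a ≠ ⊤ := (h.trans_lt ENNReal.ofReal_lt_top).ne
  by_contra hlt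
  rw [not_le] at hlt
  obtain ⟨t, ht1, ht2⟩ := EReal.lt_iff_exists_real_btwn.1 hlt
  rw [EReal.coe_lt_coe_iff] at ht2
  refine ht1.not_ge (le_of_lt ?_)
  rw [lt_inv_mul_neg_elog_add_iff hn ha]
  refine h.trans_lt ((ENNReal.ofReal_lt_ofReal_iff (Real.exp_pos _)).2 (Real.exp_lt_exp.2 ?_))
  have : (n : ℝ) * t < n * (s - b / n) := mul_lt_mul_of_pos_left ht2 hn'
  rw [mul_sub, mul_div_cancel₀ _ hn'.ne'] at this
  linarith

section Basic

variable {X : ℕ → Type*} [∀ k, MetricSpace (X k)] {T : ∀ k, X k → X (k + 1)} {f : ∀ k, X k → ℝ}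

lemma continuous_iter (hT : ∀ k, Continuous (T k)) : ∀ j, Continuous (iter T j)
  | 0 => continuous_id
  | j + 1 => (hT j).comp (continuous_iter hT j)

lemma continuous_birk (hT : ∀ k, Continuous (T k)) (hf : ∀ k, Continuous (f k)) (n : ℕ) :
    Continuous (birk T f n) :=
  continuous_finsetSum _ fun j _ => (hf j).comp (continuous_iter hT j)

lemma isOpen_bowenBall (hT : ∀ k, Continuous (T k)) (n : ℕ) (ε : ℝ) (x : X 0) :
    IsOpen (bowenBall T n ε x) := by
  have : bowenBall T n ε x = ⋂ j ∈ Finset.range n, {y | dist (iter T j x) (iter T j y) < ε} := by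
    ext y; simp [bowenBall]
  rw [this]
  exact isOpen_biInter_finset fun j _ =>
    isOpen_lt (continuous_const.dist (continuous_iter hT j)) continuous_const

lemma bowenBall_subset_bowenClosedBall (n : ℕ) (ε : ℝ) (x : X 0) :
    bowenBall T n ε x ⊆ bowenClosedBall T n ε x := fun _ hy j hj => (hy j hj).le

lemma bowenBall_mono (n : ℕ) {ε ε' : ℝ} (h : ε ≤ ε') (x : X 0) :
    bowenBall T n ε x ⊆ bowenBall T n ε' x := fun _ hy j hj => (hy j hj).trans_le h

lemma mem_bowenBall_self (n : ℕ) {ε : ℝ} (hε : 0 < ε) (x : X 0) : x ∈ bowenBall T n ε x :=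
  fun _ _ => by simpa using hε

lemma mem_bowenClosedBall_self (n : ℕ) {ε : ℝ} (hε : 0 < ε) (x : X 0) :
    x ∈ bowenClosedBall T n ε x :=
  bowenBall_subset_bowenClosedBall n ε x (mem_bowenBall_self n hε x)

lemma elog_mono {a b : ℝ≥0∞} (h : a ≤ b) : elog a ≤ elog b := by
  unfold elog
  split_ifs with h1 h2 h3 h4 <;> try simp_all
  exact Real.log_le_log (ENNReal.toReal_pos h1 h4) (ENNReal.toReal_mono ‹b ≠ ⊤› h)

lemma packPreInf_mono {s ε : ℝ} {Z Z' : Set (X 0)} (h : Z ⊆ Z') :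
    packPreInf T f s ε Z ≤ packPreInf T f s ε Z' := by
  refine iInf_mono fun N => iSup₂_le fun D hD => ?_
  exact le_iSup₂_of_le (f := fun (D : Set (X 0 × ℕ)) (_ : IsPacking T N ε Z' D) =>
    ∑' p : D, ENNReal.ofReal (Real.exp (-(p.1.2 : ℝ) * s + birk T f p.1.2 p.1.1))) D
    ⟨hD.1, fun p hp => ⟨h (hD.2.1 p hp).1, (hD.2.1 p hp).2⟩, hD.2.2⟩ le_rfl

variable [∀ k, CompactSpace (X k)] [MeasurableSpace (X 0)]
  {μ : Measure (X 0)}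

/-- A Vitali-type selection: a set of points whose Bowen balls of order `n` have small measure
carries a packing whose total weight dominates its measure. -/
lemma measure_le_packPre (hT : ∀ k, Continuous (T k)) {n N : ℕ} (hN : N ≤ n) {ε : ℝ} (hε : 0 < ε)
    {s t : ℝ} {E A : Set (X 0)} (hAE : A ⊆ E)
    (hA : ∀ x ∈ A, μ (bowenBall T n ε x) ≤ ENNReal.ofReal (Real.exp (-(n : ℝ) * s + birk T f n x))) :
    μ A ≤ ENNReal.ofReal (Real.exp (t - s)) ^ n * packPre T f t N (ε / 3) E := by
  have hε3 : 0 < ε / 3 := by positivity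
  obtain ⟨u, huA, hud, hu⟩ := Vitali.exists_disjoint_subfamily_covering_enlargement
    (fun x => bowenClosedBall T n (ε / 3) x) A (fun _ => (1 : ℝ)) 2 one_lt_two
    (fun _ _ => zero_le_one) 1 (fun _ _ => le_rfl)
    (fun x _ => ⟨x, mem_bowenClosedBall_self n hε3 x⟩)
  have hucount : u.Countable := hud.countable_of_nonempty_interior fun x _ =>
    ⟨x, mem_interior.2 ⟨_, bowenBall_subset_bowenClosedBall n _ x, isOpen_bowenBall hT n _ x,
      mem_bowenBall_self n hε3 x⟩⟩
  have hcover : A ⊆ ⋃ x ∈ u, bowenBall T n ε x := by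
    intro y hy
    obtain ⟨x, hx, ⟨z, hzy, hzx⟩, -⟩ := hu y hy
    refine mem_iUnion₂.2 ⟨x, hx, fun j hj => ?_⟩
    have h1 := dist_triangle_right (iter T j x) (iter T j y) (iter T j z)
    have h2 := hzy j hj
    have h3 := hzx j hj
    linarith
  set D : Set (X 0 × ℕ) := (fun x => (x, n)) '' u with hD
  have hpack : IsPacking T N (ε / 3) E D := by
    refine ⟨hucount.image _, ?_, ?_⟩
    · rintro _ ⟨x, hx, rfl⟩
      exact ⟨hAE (huA hx), hN⟩
    · rintro _ ⟨x, hx, rfl⟩ _ ⟨y, hy, rfl⟩ hne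
      exact hud hx hy fun h => hne (by rw [h])
  have hinj : InjOn (fun x : X 0 => (x, n)) u := fun x _ y _ h => (Prod.mk.inj h).1
  calc μ A ≤ μ (⋃ x ∈ u, bowenBall T n ε x) := measure_mono hcover
    _ ≤ ∑' x : u, μ (bowenBall T n ε x) := measure_biUnion_le μ hucount _
    _ ≤ ∑' x : u, ENNReal.ofReal (Real.exp (t - s)) ^ n *
          ENNReal.ofReal (Real.exp (-(n : ℝ) * t + birk T f n x)) := by
        refine ENNReal.tsum_le_tsum fun x => (hA x (huA x.2)).trans_eq ?_
        rw [← ENNReal.ofReal_pow (Real.exp_pos _).le, ← ENNReal.ofReal_mul (by positivity),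
          ← Real.exp_nat_mul, ← Real.exp_add]
        congr 2; ring
    _ = ENNReal.ofReal (Real.exp (t - s)) ^ n *
          ∑' p : D, ENNReal.ofReal (Real.exp (-(p.1.2 : ℝ) * t + birk T f p.1.2 p.1.1)) := by
        rw [ENNReal.tsum_mul_left, hD, tsum_image (fun p : X 0 × ℕ =>
          ENNReal.ofReal (Real.exp (-(p.2 : ℝ) * t + birk T f p.2 p.1))) hinj]
    _ ≤ _ := by
        gcongr
        exact le_iSup₂_of_le (f := fun (D : Set (X 0 × ℕ)) (_ : IsPacking T N (ε / 3) E D) =>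
          ∑' p : D, ENNReal.ofReal (Real.exp (-(p.1.2 : ℝ) * t + birk T f p.1.2 p.1.1))) D
          hpack le_rfl

lemma packPreInf_eq_top_of_measure_ne_zero [IsFiniteMeasure μ] (hT : ∀ k, Continuous (T k))
    {ε : ℝ} (hε : 0 < ε) {s t : ℝ} (hts : t < s) {E : Set (X 0)} (hμE : μ E ≠ 0)
    (hE : ∀ x ∈ E, (s : EReal) < limsup (fun n : ℕ => (((n : ℝ)⁻¹ : ℝ) : EReal) *
        (-(elog (μ (bowenBall T n ε x))) + ((birk T f n x : ℝ) : EReal))) atTop) :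
    packPreInf T f t (ε / 3) E = ⊤ := by
  refine iInf_eq_top.2 fun N => ?_
  by_contra hfin
  let q : ℝ≥0∞ := ENNReal.ofReal (Real.exp (t - s))
  have hq : q < 1 := by
    rw [← ENNReal.ofReal_one]
    exact (ENNReal.ofReal_lt_ofReal_iff one_pos).2 (Real.exp_lt_one_iff.2 (by linarith))
  let p : ℕ → X 0 → Prop := fun n x => x ∈ E ∧ N ≤ n ∧
    μ (bowenBall T n ε x) ≤ ENNReal.ofReal (Real.exp (-(n : ℝ) * s + birk T f n x))
  have hsum : ∑' n, μ {x | p n x} ≠ ⊤ := by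
    refine ne_top_of_le_ne_top ?_ (ENNReal.tsum_le_tsum
      (g := fun n => q ^ n * packPre T f t N (ε / 3) E) fun n => ?_)
    · rw [ENNReal.tsum_mul_right, ENNReal.tsum_geometric]
      exact ENNReal.mul_ne_top (ENNReal.inv_ne_top.2 (tsub_pos_of_lt hq).ne') hfin
    · by_cases hn : N ≤ n
      · exact measure_le_packPre hT hn hε (fun x hx => hx.1) fun x hx => hx.2.2
      · simp [p, hn]
  refine hμE (measure_mono_null (fun x hx => ?_) (measure_setOfPred_frequently_eq_zero hsum))
  refine ((frequently_lt_of_lt_limsup (by isBoundedDefault) (hE x hx)).and_eventually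
    ((eventually_ge_atTop N).and (eventually_ge_atTop 1))).mono fun n ⟨h1, h2, h3⟩ => ?_
  exact ⟨hx, h2, ((lt_inv_mul_neg_elog_add_iff (by omega) (measure_ne_top μ _) _ _).1 h1).le⟩

/-- The measure-theoretic upper pressure is at most the packing pressure of any set of full
measure. -/
lemma upperPres_le_packP [IsProbabilityMeasure μ] (hT : ∀ k, Continuous (T k)) {K : Set (X 0)}
    (hK : ∀ᵐ x ∂μ, x ∈ K) : upperPres μ T f ≤ packP T f K := by
  refine le_of_forall_lt fun c hc => ?_
  obtain ⟨t, hct, ht⟩ := EReal.lt_iff_exists_real_btwn.1 hc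
  obtain ⟨s, hts, hs⟩ := EReal.lt_iff_exists_real_btwn.1 ht
  refine hct.trans_le ?_
  set φ : ℝ → X 0 → EReal := fun ε x => limsup (fun n : ℕ => (((n : ℝ)⁻¹ : ℝ) : EReal) *
        (-(elog (μ (bowenBall T n ε x))) + ((birk T f n x : ℝ) : EReal))) atTop with hφ
  have hφ_anti : ∀ x ε ε', ε ≤ ε' → φ ε' x ≤ φ ε x := by
    intro x ε ε' h
    refine limsup_le_limsup (Eventually.of_forall fun n => ?_)
    refine mul_le_mul_of_nonneg_left ?_ (by exact_mod_cast inv_nonneg.2 (Nat.cast_nonneg n))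
    gcongr
    exact EReal.neg_le_neg_iff.2 (elog_mono (measure_mono (bowenBall_mono n h x)))
  obtain ⟨m, hm⟩ : ∃ m : ℕ, μ {x ∈ K | (s : EReal) < φ (1 / (m + 1)) x} ≠ 0 := by
    by_contra! hall
    refine hs.not_ge (eInt_le_of_ae_le ?_)
    have := measure_iUnion_null hall
    filter_upwards [hK, compl_mem_ae_iff.2 this] with x hxK hx
    refine iSup₂_le fun ε hε => ?_
    obtain ⟨m, hm⟩ := exists_nat_one_div_lt hε
    refine (hφ_anti x _ _ hm.le).trans (not_lt.1 fun hlt => hx ?_)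
    exact mem_iUnion.2 ⟨m, hxK, hlt⟩
  set ε : ℝ := 1 / (m + 1) with hεdef
  have hε : 0 < ε := by positivity
  refine le_iSup₂_of_le (f := fun (ε : ℝ) (_ : 0 < ε) => packCrit T f ε K) (ε / 3)
    (by positivity) (le_iInf₂ fun r hr => ?_)
  by_contra hlt
  rw [not_le, EReal.coe_lt_coe_iff] at hlt
  rw [EReal.coe_lt_coe_iff] at hts
  refine ENNReal.top_ne_zero (hr ▸ eq_comm.1 (top_le_iff.1 (le_iInf₂ fun Zs hZs => ?_)))
  obtain ⟨i, hi⟩ : ∃ i, μ ({x ∈ K | (s : EReal) < φ ε x} ∩ Zs i) ≠ 0 := by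
    by_contra! hall
    refine hm (measure_mono_null (fun x hx => ?_) (measure_iUnion_null hall))
    obtain ⟨i, hi⟩ := mem_iUnion.1 (hZs hx.1)
    exact mem_iUnion.2 ⟨i, hx, hi⟩
  rw [ENNReal.tsum_eq_top_of_eq_top ⟨i, ?_⟩]
  refine top_le_iff.1 ((packPreInf_eq_top_of_measure_ne_zero (f := f) hT hε (hlt.trans hts) hi
    fun x hx => hx.1.2).ge.trans (packPreInf_mono inter_subset_right))

end Basic

section Support

variable {X : ℕ → Type*} [∀ k, MetricSpace (X k)] {T : ∀ k, X k → X (k + 1)} {f : ∀ k, X k → ℝ}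

lemma packPreInf_empty (s ε : ℝ) : packPreInf T f s ε ∅ = 0 := by
  refine le_antisymm (iInf_le_of_le 0 (iSup₂_le fun D hD => ?_)) bot_le
  have : D = ∅ := eq_empty_of_forall_notMem fun p hp => (hD.2.1 p hp).1
  subst this
  simp

/-- The quantity `P^s_ε(T,f,·)` as an outer measure. -/
noncomputable def packOuter (T : ∀ k, X k → X (k + 1)) (f : ∀ k, X k → ℝ) (s ε : ℝ) :
    OuterMeasure (X 0) :=
  OuterMeasure.ofFunction (packPreInf T f s ε) (packPreInf_empty s ε)

lemma packPreInf_eq_top {s t ε : ℝ} (hst : s < t) {Z : Set (X 0)}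
    (h : packPreInf T f t ε Z ≠ 0) : packPreInf T f s ε Z = ⊤ := by
  refine iInf_eq_top.2 fun N => ?_
  have hbound : ∀ n : ℕ, N ≤ n → ENNReal.ofReal (Real.exp (t - s)) ^ n * packPreInf T f t ε Z ≤
      packPre T f s N ε Z := by
    intro n hn
    refine (mul_le_mul_right (iInf_le _ n) _).trans ?_
    simp only [packPre, ENNReal.mul_iSup]
    refine iSup₂_le fun D hD => ?_
    refine le_iSup₂_of_le (f := fun (D : Set (X 0 × ℕ)) (_ : IsPacking T N ε Z D) =>
      ∑' p : D, ENNReal.ofReal (Real.exp (-(p.1.2 : ℝ) * s + birk T f p.1.2 p.1.1))) D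
      ⟨hD.1, fun p hp => ⟨(hD.2.1 p hp).1, hn.trans (hD.2.1 p hp).2⟩, hD.2.2⟩ ?_
    rw [← ENNReal.tsum_mul_left]
    refine ENNReal.tsum_le_tsum fun p => ?_
    rw [← ENNReal.ofReal_pow (Real.exp_pos _).le, ← ENNReal.ofReal_mul (by positivity),
      ← Real.exp_nat_mul, ← Real.exp_add]
    refine ENNReal.ofReal_le_ofReal (Real.exp_le_exp.2 ?_)
    have h1 : (n : ℝ) ≤ p.1.2 := by exact_mod_cast (hD.2.1 _ p.2).2
    nlinarith [mul_le_mul_of_nonneg_right h1 (sub_pos.2 hst).le]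
  have hq : 1 < ENNReal.ofReal (Real.exp (t - s)) := by
    rw [← ENNReal.ofReal_one]
    exact (ENNReal.ofReal_lt_ofReal_iff (Real.exp_pos _)).2 (Real.one_lt_exp_iff.2 (by linarith))
  have hlim := ENNReal.Tendsto.mul_const (b := packPreInf T f t ε Z)
    (ENNReal.tendsto_pow_atTop_nhds_top_iff.2 hq) (Or.inl ENNReal.top_ne_zero)
  rw [ENNReal.top_mul h] at hlim
  exact top_le_iff.1 (le_of_tendsto hlim ((eventually_ge_atTop N).mono hbound))

/-- A set of positive packing measure at parameter `t` contains a nonempty part, every portion of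
which has infinite packing premeasure at each smaller parameter. -/
lemma exists_subset_forall_packPreInf_eq_top [∀ k, CompactSpace (X k)] {s t ε : ℝ} (hst : s < t)
    {K : Set (X 0)} (hK : packMeasure T f t ε K ≠ 0) :
    ∃ Z ⊆ K, Z.Nonempty ∧
      ∀ x ∈ Z, ∀ r > 0, packPreInf T f s ε (Z ∩ Metric.ball x r) = ⊤ := by
  set m := packOuter T f t ε with hm
  set Z : Set (X 0) := {x ∈ K | ∀ u ∈ 𝓝[K] x, m u ≠ 0} with hZ
  have hZK : Z ⊆ K := fun x hx => hx.1
  have hnull : m (K \ Z) = 0 := by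
    refine measure_null_of_locally_null _ fun x hx => ?_
    have : ∃ u ∈ 𝓝[K] x, m u = 0 := by
      by_contra! hall
      exact hx.2 ⟨hx.1, hall⟩
    obtain ⟨u, hu, hu0⟩ := this
    exact ⟨u, nhdsWithin_mono _ sdiff_subset hu, hu0⟩
  have hpos : ∀ G : Set (X 0), m (K ∩ G) ≠ 0 → m (Z ∩ G) ≠ 0 := by
    intro G hG h0
    refine hG (measure_mono_null (t := Z ∩ G ∪ K \ Z) (fun x hx => ?_)
      (measure_union_null h0 hnull))
    by_cases hxZ : x ∈ Z
    · exact Or.inl ⟨hxZ, hx.2⟩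
    · exact Or.inr ⟨hx.1, hxZ⟩
  refine ⟨Z, hZK, ?_, fun x hx r hr => packPreInf_eq_top hst fun h0 => ?_⟩
  · refine nonempty_iff_ne_empty.2 fun hempty => hK ?_
    rw [hempty, sdiff_empty] at hnull
    exact hnull
  · refine hpos (Metric.ball x r) (hx.2 _ (inter_mem_nhdsWithin K (Metric.ball_mem_nhds x hr))) ?_
    refine le_antisymm (((OuterMeasure.ofFunction_le _).trans_eq h0)) bot_le

end Support

section Construction

variable {X : ℕ → Type*} [∀ k, MetricSpace (X k)] {T : ∀ k, X k → X (k + 1)} {f : ∀ k, X k → ℝ}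

/-- The weight `exp (-n s + S_n^T f (x))` of a Bowen ball, indexed by its center and order. -/
noncomputable def bowenWeight (T : ∀ k, X k → X (k + 1)) (f : ∀ k, X k → ℝ) (s : ℝ)
    (p : X 0 × ℕ) : ℝ≥0∞ :=
  ENNReal.ofReal (Real.exp (-(p.2 : ℝ) * s + birk T f p.2 p.1))

omit [∀ k, MetricSpace (X k)] in
lemma bowenWeight_ne_top (s : ℝ) (p : X 0 × ℕ) : bowenWeight T f s p ≠ ⊤ := ENNReal.ofReal_ne_top

lemma exists_finset_packing {s ε : ℝ} (hε : 0 < ε) {Z : Set (X 0)}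
    (h : packPreInf T f s ε Z = ⊤) (N : ℕ) {a : ℝ≥0∞} (ha : a ≠ ⊤) :
    ∃ E : Finset (X 0 × ℕ), (∀ p ∈ E, p.1 ∈ Z ∧ N ≤ p.2) ∧
      (∀ p ∈ E, ∀ q ∈ E, p ≠ q → ∃ j < p.2, ε < dist (iter T j p.1) (iter T j q.1)) ∧
      a < ∑ p ∈ E, bowenWeight T f s p := by
  have hN : a < packPre T f s N ε Z := by
    rw [iInf_eq_top.1 h N]; exact lt_top_iff_ne_top.2 ha
  obtain ⟨D, hD⟩ := lt_iSup_iff.1 hN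
  obtain ⟨hpack, hD⟩ := lt_iSup_iff.1 hD
  rw [ENNReal.tsum_eq_iSup_sum] at hD
  obtain ⟨E, hE⟩ := lt_iSup_iff.1 hD
  refine ⟨E.map (Function.Embedding.subtype _), ?_, ?_, by rwa [Finset.sum_map]⟩
  · intro p hp
    obtain ⟨p, -, rfl⟩ := Finset.mem_map.1 hp
    exact hpack.2.1 _ p.2
  · intro p hp q hq hne
    obtain ⟨p, -, rfl⟩ := Finset.mem_map.1 hp
    obtain ⟨q, -, rfl⟩ := Finset.mem_map.1 hq
    have := hpack.2.2 _ p.2 _ q.2 hne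
    have hnot : q.1.1 ∉ bowenClosedBall T p.1.2 ε p.1.1 := fun hq' =>
      this.le_bot ⟨hq', mem_bowenClosedBall_self _ hε _⟩
    simpa [bowenClosedBall] using hnot

/-- A finite approximation to the measure built in the variational principle: a finite family of
centers and orders in `Z` whose Bowen balls stay apart under perturbations of the centers by `rad`,
with weights of total mass one dominated by the weights of the balls. -/
structure FinApprox (T : ∀ k, X k → X (k + 1)) (f : ∀ k, X k → ℝ) (s ε : ℝ) (Z : Set (X 0)) where
  /-- the centers and orders -/
  pts : Finset (X 0 × ℕ)
  /-- the masses -/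
  wt : X 0 × ℕ → ℝ≥0∞
  /-- the admissible perturbation of the centers -/
  rad : ℝ
  rad_pos : 0 < rad
  mem : ∀ p ∈ pts, p.1 ∈ Z
  sum_wt : ∑ p ∈ pts, wt p = 1
  wt_le : ∀ p ∈ pts, wt p ≤ bowenWeight T f s p
  sep : ∀ p ∈ pts, ∀ q ∈ pts, p ≠ q → ∀ z w, dist z p.1 ≤ rad → dist w q.1 ≤ rad →
    ∃ j < p.2, ε < dist (iter T j z) (iter T j w)
  birk_le : ∀ p ∈ pts, ∀ z, dist z p.1 ≤ rad → birk T f p.2 p.1 ≤ birk T f p.2 z + 1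

namespace FinApprox

variable {s ε : ℝ} {Z : Set (X 0)}

/-- The mass given to a set by a finite approximation. -/
noncomputable def mass (S : FinApprox T f s ε Z) (A : Set (X 0)) : ℝ≥0∞ :=
  ∑ p ∈ S.pts, A.indicator (fun _ => S.wt p) p.1

lemma mass_mono (S : FinApprox T f s ε Z) {A B : Set (X 0)} (h : A ⊆ B) : S.mass A ≤ S.mass B :=
  Finset.sum_le_sum fun _ _ => indicator_le_indicator_of_subset h (fun _ => zero_le) _

/-- The probability measure associated with a finite approximation. -/
noncomputable def toMeasure [MeasurableSpace (X 0)] (S : FinApprox T f s ε Z) : Measure (X 0) :=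
  ∑ p ∈ S.pts, S.wt p • Measure.dirac p.1

lemma toMeasure_apply [MeasurableSpace (X 0)] (S : FinApprox T f s ε Z) {A : Set (X 0)}
    (hA : MeasurableSet A) : S.toMeasure A = S.mass A := by
  rw [toMeasure, mass, Measure.finsetSum_apply]
  refine Finset.sum_congr rfl fun p _ => ?_
  rw [Measure.smul_apply, Measure.dirac_apply' _ hA]
  by_cases h : p.1 ∈ A <;> simp [h]

instance isProbabilityMeasure_toMeasure [MeasurableSpace (X 0)] (S : FinApprox T f s ε Z) :
    IsProbabilityMeasure S.toMeasure :=
  ⟨by simp [S.toMeasure_apply MeasurableSet.univ, mass, S.sum_wt]⟩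

/-- The one-point approximation. -/
noncomputable def singleton {x : X 0} (hx : x ∈ Z) : FinApprox T f s ε Z where
  pts := {(x, 0)}
  wt := fun _ => 1
  rad := 1
  rad_pos := one_pos
  mem := by simpa using hx
  sum_wt := by simp
  wt_le := by simp [bowenWeight, birk]
  sep := by simp
  birk_le := by simp [birk]

lemma eventually_forall_dist_le {E F : Type*} [PseudoMetricSpace E] [PseudoMetricSpace F]
    {x : E} {y : F} {P : E → F → Prop} (h : ∀ᶠ p in 𝓝 (x, y), P p.1 p.2) :
    ∀ᶠ r in 𝓝[>] (0 : ℝ), ∀ z w, dist z x ≤ r → dist w y ≤ r → P z w := by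
  obtain ⟨δ, hδ, hP⟩ := Metric.eventually_nhds_iff.1 h
  filter_upwards [Ioo_mem_nhdsGT hδ] with r hr z w hz hw
  exact hP (y := (z, w)) (max_lt (hz.trans_lt hr.2) (hw.trans_lt hr.2))

lemma exists_rad (hT : ∀ k, Continuous (T k)) (hf : ∀ k, Continuous (f k)) {ρ : ℝ} (hρ : 0 < ρ)
    {E : Finset (X 0 × ℕ)}
    (hE : ∀ p ∈ E, ∀ q ∈ E, p ≠ q → ∃ j < p.2, ε < dist (iter T j p.1) (iter T j q.1)) :
    ∃ r > 0, r ≤ ρ ∧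
      (∀ p ∈ E, ∀ q ∈ E, p ≠ q → ∀ z w, dist z p.1 ≤ r → dist w q.1 ≤ r →
        ∃ j < p.2, ε < dist (iter T j z) (iter T j w)) ∧
      ∀ p ∈ E, ∀ z, dist z p.1 ≤ r → birk T f p.2 p.1 ≤ birk T f p.2 z + 1 := by
  have h1 : ∀ᶠ r in 𝓝[>] (0 : ℝ), ∀ p ∈ E, ∀ q ∈ E, p ≠ q → ∀ z w, dist z p.1 ≤ r →
      dist w q.1 ≤ r → ∃ j < p.2, ε < dist (iter T j z) (iter T j w) := by
    refine (Filter.eventually_all_finset E).2 fun p hp =>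
      (Filter.eventually_all_finset E).2 fun q hq => ?_
    by_cases hne : p = q
    · simp [hne]
    obtain ⟨j, hj, hlt⟩ := hE p hp q hq hne
    have hc : Continuous fun y : X 0 × X 0 => dist (iter T j y.1) (iter T j y.2) :=
      ((continuous_iter hT j).comp continuous_fst).dist ((continuous_iter hT j).comp continuous_snd)
    have := eventually_forall_dist_le (x := p.1) (y := q.1)
      (P := fun z w => ε < dist (iter T j z) (iter T j w))
      (hc.continuousAt.eventually_const_lt hlt)
    exact this.mono fun r hr _ z w hz hw => ⟨j, hj, hr z w hz hw⟩
  have h2 : ∀ᶠ r in 𝓝[>] (0 : ℝ), ∀ p ∈ E, ∀ z, dist z p.1 ≤ r →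
      birk T f p.2 p.1 ≤ birk T f p.2 z + 1 := by
    refine (Filter.eventually_all_finset E).2 fun p hp => ?_
    have hc : Continuous fun y : X 0 × X 0 => birk T f p.2 y.1 :=
      (continuous_birk hT hf p.2).comp continuous_fst
    have := eventually_forall_dist_le (x := p.1) (y := p.1)
      (P := fun z _ => birk T f p.2 p.1 - 1 < birk T f p.2 z)
      (hc.continuousAt.eventually_const_lt (by simp))
    exact this.mono fun r hr z hz => by linarith [hr z z hz hz]
  obtain ⟨r, h1, h2, hr⟩ := (h1.and (h2.and (Ioo_mem_nhdsGT hρ))).exists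
  exact ⟨r, hr.1, hr.2.le, h1, h2⟩

/-- Each finite approximation can be refined by one with arbitrarily large orders. -/
lemma exists_next (hT : ∀ k, Continuous (T k)) (hf : ∀ k, Continuous (f k)) (hε : 0 < ε)
    (hZ : ∀ x ∈ Z, ∀ r > 0, packPreInf T f s ε (Z ∩ Metric.ball x r) = ⊤)
    (S : FinApprox T f s ε Z) (N : ℕ) :
    ∃ S' : FinApprox T f s ε Z, S'.rad ≤ S.rad / 2 ∧ (∀ p ∈ S'.pts, N ≤ p.2) ∧
      ∀ A, S'.mass A ≤ S.mass {y | ∃ a ∈ A, dist y a ≤ S.rad / 8} := by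
  classical
  have hr8 : 0 < S.rad / 8 := by linarith [S.rad_pos]
  have hex : ∀ p, ∃ E : Finset (X 0 × ℕ), p ∈ S.pts →
      (∀ q ∈ E, q.1 ∈ Z ∩ Metric.ball p.1 (S.rad / 8) ∧ max N (S.pts.sup Prod.snd) ≤ q.2) ∧
      (∀ p ∈ E, ∀ q ∈ E, p ≠ q → ∃ j < p.2, ε < dist (iter T j p.1) (iter T j q.1)) ∧
      bowenWeight T f s p < ∑ q ∈ E, bowenWeight T f s q := by
    intro p
    by_cases hp : p ∈ S.pts
    · obtain ⟨E, hE⟩ := exists_finset_packing hε (hZ p.1 (S.mem p hp) _ hr8)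
        (max N (S.pts.sup Prod.snd)) (bowenWeight_ne_top s p)
      exact ⟨E, fun _ => hE⟩
    · exact ⟨∅, fun h => absurd h hp⟩
  choose E hE using hex
  let W : X 0 × ℕ → ℝ≥0∞ := fun p => ∑ q ∈ E p, bowenWeight T f s q
  have hW0 : ∀ p ∈ S.pts, W p ≠ 0 := fun p hp => (bot_le.trans_lt (hE p hp).2.2).ne'
  have hWt : ∀ p, W p ≠ ⊤ := fun p => ENNReal.sum_ne_top.2 fun q _ => bowenWeight_ne_top s q
  have hdist : ∀ p ∈ S.pts, ∀ q ∈ E p, dist q.1 p.1 ≤ S.rad / 8 := fun p hp q hq =>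
    (((hE p hp).1 q hq).1.2).le
  have hdisj : ∀ p ∈ S.pts, ∀ p' ∈ S.pts, ∀ q ∈ E p, ∀ q' ∈ E p', p ≠ p' →
      ∃ j < p.2, ε < dist (iter T j q.1) (iter T j q'.1) := fun p hp p' hp' q hq q' hq' hne =>
    S.sep p hp p' hp' hne _ _ ((hdist p hp q hq).trans (by linarith))
      ((hdist p' hp' q' hq').trans (by linarith))
  have huniq : ∀ p ∈ S.pts, ∀ p' ∈ S.pts, ∀ q ∈ E p, q ∈ E p' → p = p' := by
    intro p hp p' hp' q hq hq'
    by_contra hne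
    obtain ⟨j, -, hj⟩ := hdisj p hp p' hp' q hq q hq' hne
    rw [dist_self] at hj
    exact hj.not_gt hε
  let c : X 0 × ℕ → ℝ≥0∞ := fun q =>
    ∑ p ∈ S.pts, if q ∈ E p then S.wt p * (bowenWeight T f s q / W p) else 0
  have hc : ∀ p ∈ S.pts, ∀ q ∈ E p, c q = S.wt p * (bowenWeight T f s q / W p) := by
    intro p hp q hq
    simp only [c]
    rw [Finset.sum_eq_single_of_mem p hp, if_pos hq]
    intro p' hp' hne
    exact if_neg fun hq' => hne (huniq p' hp' p hp q hq' hq)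
  have hcsum : ∀ p ∈ S.pts, ∑ q ∈ E p, c q = S.wt p := by
    intro p hp
    rw [Finset.sum_congr rfl (hc p hp), ← Finset.mul_sum]
    simp only [div_eq_mul_inv]
    rw [← Finset.sum_mul, ENNReal.mul_inv_cancel (hW0 p hp) (hWt p), mul_one]
  have hpd : (S.pts : Set (X 0 × ℕ)).PairwiseDisjoint E := fun p hp p' hp' hne =>
    Finset.disjoint_left.2 fun q hq hq' => hne (huniq p hp p' hp' q hq hq')
  have hsep : ∀ q ∈ S.pts.biUnion E, ∀ q' ∈ S.pts.biUnion E, q ≠ q' →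
      ∃ j < q.2, ε < dist (iter T j q.1) (iter T j q'.1) := by
    intro q hq q' hq' hne
    obtain ⟨p, hp, hq⟩ := Finset.mem_biUnion.1 hq
    obtain ⟨p', hp', hq'⟩ := Finset.mem_biUnion.1 hq'
    by_cases h : p = p'
    · subst h
      exact (hE p hp).2.1 q hq q' hq' hne
    · obtain ⟨j, hj, hlt⟩ := hdisj p hp p' hp' q hq q' hq' h
      have h1 : p.2 ≤ S.pts.sup Prod.snd := Finset.le_sup (f := Prod.snd) hp
      exact ⟨j, hj.trans_le (h1.trans ((le_max_right _ _).trans ((hE p hp).1 q hq).2)), hlt⟩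
  obtain ⟨r, hr, hrρ, hr1, hr2⟩ := exists_rad hT hf (half_pos S.rad_pos) hsep
  refine ⟨{ pts := S.pts.biUnion E, wt := c, rad := r, rad_pos := hr, mem := ?_, sum_wt := ?_,
            wt_le := ?_, sep := hr1, birk_le := hr2 }, hrρ, ?_, fun A => ?_⟩
  · intro q hq
    obtain ⟨p, hp, hq⟩ := Finset.mem_biUnion.1 hq
    exact ((hE p hp).1 q hq).1.1
  · rw [Finset.sum_biUnion hpd, Finset.sum_congr rfl hcsum, S.sum_wt]
  · intro q hq
    obtain ⟨p, hp, hq⟩ := Finset.mem_biUnion.1 hq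
    rw [hc p hp q hq]
    calc S.wt p * (bowenWeight T f s q / W p) ≤ W p * (bowenWeight T f s q / W p) := by
          gcongr
          exact (S.wt_le p hp).trans (hE p hp).2.2.le
      _ = bowenWeight T f s q := ENNReal.mul_div_cancel (hW0 p hp) (hWt p)
  · intro q hq
    obtain ⟨p, hp, hq⟩ := Finset.mem_biUnion.1 hq
    exact (le_max_left _ _).trans ((hE p hp).1 q hq).2
  · simp only [mass]
    rw [Finset.sum_biUnion hpd]
    refine Finset.sum_le_sum fun p hp => ?_
    by_cases hA : ∃ a ∈ A, dist p.1 a ≤ S.rad / 8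
    · rw [indicator_of_mem (show p.1 ∈ {y | ∃ a ∈ A, dist y a ≤ S.rad / 8} from hA), ← hcsum p hp]
      exact Finset.sum_le_sum fun q _ => indicator_le_self' (fun _ _ => zero_le) q.1
    · refine (Finset.sum_eq_zero fun q hq => indicator_of_notMem (fun hqA => hA ?_) _).trans_le
        zero_le
      exact ⟨q.1, hqA, by rw [dist_comm]; exact hdist p hp q hq⟩

/-- The sets charged by the terms of a sequence of refinements are controlled by earlier terms. -/
lemma mass_le_of_refinement {S : ℕ → FinApprox T f s ε Z}
    (hrad : ∀ i, (S (i + 1)).rad ≤ (S i).rad / 2)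
    (hmass : ∀ i A, (S (i + 1)).mass A ≤ (S i).mass {y | ∃ a ∈ A, dist y a ≤ (S i).rad / 8})
    {i j : ℕ} (hij : i ≤ j) (A : Set (X 0)) :
    (S j).mass A ≤ (S i).mass {y | ∃ a ∈ A, dist y a ≤ (S i).rad / 4} := by
  have key : ∀ A : Set (X 0), (S j).mass A ≤
      (S i).mass {y | ∃ a ∈ A, dist y a ≤ (S i).rad / 4 - (S j).rad / 4} := by
    induction j, hij using Nat.le_induction with
    | base => exact fun A => mass_mono _ fun a ha => ⟨a, ha, by simp⟩
    | succ j _ ih =>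
      refine fun A => (hmass j A).trans ((ih _).trans (mass_mono _ ?_))
      rintro y ⟨b, ⟨a, ha, hba⟩, hyb⟩
      refine ⟨a, ha, (dist_triangle y b a).trans ?_⟩
      linarith [hrad j]
  refine (key A).trans (mass_mono _ ?_)
  rintro y ⟨a, ha, hya⟩
  exact ⟨a, ha, hya.trans (by linarith [(S j).rad_pos])⟩

end FinApprox

end Construction

section LowerBound

variable {X : ℕ → Type*} [∀ k, MetricSpace (X k)] [MeasurableSpace (X 0)]
  {T : ∀ k, X k → X (k + 1)} {f : ∀ k, X k → ℝ}

lemma le_localUpperPres {μ : Measure (X 0)} {s ε b : ℝ} (hε : 0 < ε) {z : X 0}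
    (h : ∀ i : ℕ, ∃ n ≥ i, μ (bowenBall T n ε z) ≤
      ENNReal.ofReal (Real.exp (-(n : ℝ) * s + birk T f n z + b))) :
    (s : EReal) ≤ localUpperPres μ T f z := by
  refine le_iSup₂_of_le (f := fun (ε : ℝ) (_ : 0 < ε) => limsup (fun n : ℕ =>
      (((n : ℝ)⁻¹ : ℝ) : EReal) *
        (-(elog (μ (bowenBall T n ε z))) + ((birk T f n z : ℝ) : EReal))) atTop) ε hε ?_
  refine le_of_forall_lt fun c hc => ?_
  obtain ⟨r, hcr, hr⟩ := EReal.lt_iff_exists_real_btwn.1 hc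
  rw [EReal.coe_lt_coe_iff] at hr
  refine hcr.trans_le (le_limsup_of_frequently_le' ?_)
  have hlim : ∀ᶠ n : ℕ in atTop, r < s - b / n := by
    have : Tendsto (fun n : ℕ => s - b / n) atTop (𝓝 (s - 0)) :=
      tendsto_const_nhds.sub (tendsto_const_div_atTop_nhds_zero_nat b)
    exact this.eventually_const_lt (by simpa using hr)
  have hfreq : ∃ᶠ n : ℕ in atTop, μ (bowenBall T n ε z) ≤
      ENNReal.ofReal (Real.exp (-(n : ℝ) * s + birk T f n z + b)) :=
    frequently_atTop.2 h
  refine (hfreq.and_eventually (hlim.and (eventually_ge_atTop 1))).mono fun n ⟨h1, h2, h3⟩ => ?_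
  exact (EReal.coe_le_coe_iff.2 h2.le).trans (sub_le_inv_mul_neg_elog_add (by omega) h1)

/-- Below the packing pressure of a compact set there are probability measures on that set with
large upper pressure. -/
lemma exists_le_upperPres [∀ k, CompactSpace (X k)] [BorelSpace (X 0)]
    (hT : ∀ k, Continuous (T k)) (hf : ∀ k, Continuous (f k)) {K : Set (X 0)} (hK : IsCompact K)
    {s : ℝ} (hs : (s : EReal) < packP T f K) :
    ∃ μ : Measure (X 0), (IsProbabilityMeasure μ ∧ μ K = 1) ∧ (s : EReal) ≤ upperPres μ T f := by
  obtain ⟨ε, hs⟩ := lt_iSup_iff.1 hs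
  obtain ⟨hε, hs⟩ := lt_iSup_iff.1 hs
  obtain ⟨t, hst, ht⟩ := EReal.lt_iff_exists_real_btwn.1 hs
  rw [EReal.coe_lt_coe_iff] at hst
  have hKt : packMeasure T f t ε K ≠ 0 := fun h0 =>
    ht.not_ge (iInf₂_le (f := fun (s : ℝ) (_ : packMeasure T f s ε K = 0) => (s : EReal)) t h0)
  obtain ⟨Z, hZK, ⟨x₀, hx₀⟩, hZ⟩ := exists_subset_forall_packPreInf_eq_top hst hKt
  choose next hnext using FinApprox.exists_next hT hf hε hZ
  let S : ℕ → FinApprox T f s ε Z := fun i =>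
    Nat.rec (FinApprox.singleton hx₀) (fun i S => next S (i + 1)) i
  have hrad : ∀ i, (S (i + 1)).rad ≤ (S i).rad / 2 := fun i => (hnext (S i) (i + 1)).1
  have hord : ∀ i, ∀ p ∈ (S i).pts, i ≤ p.2 := by
    rintro (_ | i)
    · exact fun _ _ => Nat.zero_le _
    · exact (hnext (S i) (i + 1)).2.1
  have hmass : ∀ i A, (S (i + 1)).mass A ≤ (S i).mass {y | ∃ a ∈ A, dist y a ≤ (S i).rad / 8} :=
    fun i => (hnext (S i) (i + 1)).2.2
  obtain ⟨μ, hμ⟩ := exists_probabilityMeasure_limit_open_le fun i : ℕ =>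
    (⟨(S i).toMeasure, (S i).isProbabilityMeasure_toMeasure⟩ : ProbabilityMeasure (X 0))
  have hopen : ∀ i (G : Set (X 0)), IsOpen G →
      (μ : Measure (X 0)) G ≤ (S i).mass {y | ∃ a ∈ G, dist y a ≤ (S i).rad / 4} := by
    refine fun i G hG => hμ G hG _ ((eventually_ge_atTop i).mono fun j hij => ?_)
    exact ((S j).toMeasure_apply hG.measurableSet).trans_le
      (FinApprox.mass_le_of_refinement hrad hmass hij G)
  let F : ℕ → Set (X 0) := fun i => ⋃ p ∈ (S i).pts, Metric.closedBall p.1 ((S i).rad / 4)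
  have hF : ∀ i, (μ : Measure (X 0)) (F i)ᶜ = 0 := by
    intro i
    have hclosed : IsClosed (F i) :=
      (S i).pts.finite_toSet.isClosed_biUnion fun p _ => Metric.isClosed_closedBall
    refine le_antisymm ((hopen i _ hclosed.isOpen_compl).trans_eq ?_) bot_le
    refine Finset.sum_eq_zero fun p hp => indicator_of_notMem ?_ _
    rintro ⟨a, ha, hpa⟩
    exact ha (mem_iUnion₂.2 ⟨p, hp, by rwa [Metric.mem_closedBall, dist_comm]⟩)
  have hμK : (μ : Measure (X 0)) Kᶜ = 0 := by
    refine le_antisymm (hμ _ hK.isClosed.isOpen_compl 0 (Eventually.of_forall fun i => ?_)) bot_le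
    refine ((S i).toMeasure_apply hK.isClosed.isOpen_compl.measurableSet).trans_le ?_
    exact (Finset.sum_eq_zero fun p hp =>
      indicator_of_notMem (not_not.2 (hZK ((S i).mem p hp))) _).le
  have hball : ∀ i, ∀ p ∈ (S i).pts,
      (μ : Measure (X 0)) (Metric.ball p.1 ((S i).rad / 2)) ≤ bowenWeight T f s p := by
    intro i p hp
    have hr := (S i).rad_pos
    refine (hopen i _ Metric.isOpen_ball).trans (le_trans ?_ ((S i).wt_le p hp))
    rw [FinApprox.mass, Finset.sum_eq_single_of_mem p hp]
    · exact indicator_le_self' (fun _ _ => zero_le) p.1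
    · refine fun q hq hne => indicator_of_notMem ?_ _
      rintro ⟨a, ha, hqa⟩
      rw [Metric.mem_ball] at ha
      obtain ⟨j, -, hj⟩ := (S i).sep p hp q hq hne.symm q.1 q.1
        (by linarith [dist_triangle q.1 a p.1]) (by simpa using hr.le)
      rw [dist_self] at hj
      exact hj.not_gt hε
  refine ⟨μ, ⟨inferInstance, (prob_compl_eq_zero_iff hK.isClosed.measurableSet).1 hμK⟩, ?_⟩
  refine le_eInt_of_ae_le ?_
  have hFae : ∀ᵐ z ∂(μ : Measure (X 0)), ∀ i, z ∈ F i :=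
    ae_all_iff.2 fun i => mem_ae_iff.2 (hF i)
  filter_upwards [hFae] with z hz
  refine le_localUpperPres hε (b := 1) fun i => ?_
  obtain ⟨p, hp, hzp⟩ := mem_iUnion₂.1 (hz i)
  have hr := (S i).rad_pos
  rw [Metric.mem_closedBall] at hzp
  refine ⟨p.2, hord i p hp, ?_⟩
  have hsub : bowenBall T p.2 ε z ⊆ Metric.ball p.1 ((S i).rad / 2) ∪ (F i)ᶜ := by
    intro y hy
    by_cases hyF : y ∈ F i
    · obtain ⟨q, hq, hyq⟩ := mem_iUnion₂.1 hyF
      rw [Metric.mem_closedBall] at hyq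
      by_cases hpq : p = q
      · subst hpq
        exact Or.inl (Metric.mem_ball.2 (by linarith))
      · obtain ⟨j, hj, hlt⟩ := (S i).sep p hp q hq hpq z y (by linarith) (by linarith)
        exact absurd (hy j hj) hlt.not_gt
    · exact Or.inr hyF
  calc (μ : Measure (X 0)) (bowenBall T p.2 ε z)
      ≤ (μ : Measure (X 0)) (Metric.ball p.1 ((S i).rad / 2)) + (μ : Measure (X 0)) (F i)ᶜ :=
        (measure_mono hsub).trans (measure_union_le _ _)
    _ ≤ bowenWeight T f s p := by rw [hF, add_zero]; exact hball i p hp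
    _ ≤ _ := ENNReal.ofReal_le_ofReal (Real.exp_le_exp.2 (by
        linarith [(S i).birk_le p hp z (by linarith)]))

end LowerBound

end NDS

open NDS in
/-- Variational principle for the packing pressure.
If `f` is equicontinuous and uniformly bounded (`‖f‖ < ∞`) and
`P^P(T,f,K) > ‖f‖` for a non-empty compact `K ⊆ X 0`, then
`P^P(T,f,K) = sup { P̄_μ(T,f) : μ Borel probability measure on X 0 with μ(K) = 1 }`. -/
theorem stmt5 {X : ℕ → Type*} [∀ k, MetricSpace (X k)] [∀ k, CompactSpace (X k)]
    [MeasurableSpace (X 0)] [BorelSpace (X 0)]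
    (T : ∀ k, X k → X (k + 1)) (hT : ∀ k, Continuous (T k))
    (f : ∀ k, X k → ℝ) (hf : ∀ k, Continuous (f k)) (hfe : EquicontPotential f)
    (hbdd : ∃ C : ℝ, ∀ k (x : X k), |f k x| ≤ C)
    (K : Set (X 0)) (hK : IsCompact K) (hKne : K.Nonempty)
    (hgt : ((fnorm f : ℝ) : EReal) < packP T f K) :
    packP T f K =
      ⨆ (μ : MeasureTheory.Measure (X 0))
        (_ : MeasureTheory.IsProbabilityMeasure μ ∧ μ K = 1), upperPres μ T f := by
  refine le_antisymm (le_of_forall_lt fun c hc => ?_) (iSup₂_le fun μ hμ => ?_)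
  · obtain ⟨s, hcs, hs⟩ := EReal.lt_iff_exists_real_btwn.1 hc
    obtain ⟨μ, hμ, hle⟩ := exists_le_upperPres hT hf hK hs
    exact hcs.trans_le (hle.trans (le_iSup₂_of_le (f := fun (μ : MeasureTheory.Measure (X 0))
      (_ : MeasureTheory.IsProbabilityMeasure μ ∧ μ K = 1) => upperPres μ T f) μ hμ le_rfl))
  · have := hμ.1
    exact upperPres_le_packP hT
      (mem_ae_iff.2 ((prob_compl_eq_zero_iff hK.isClosed.measurableSet).2 hμ.2))
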